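/- arXiv:2308.07473 — 8 statements merged into one kernel-verified Lean document; each statement's English description precedes it below -/
import Mathlib

section
/- Suppose f is supermodular and monotone. If 0 ≤ t₁ ≤ t₂ and S₁ is a maximizer of μ_a(·, t₁), then for every S₂ ⊆ [n] it holds that μ_a(S₁ ∪ S₂, t₂) ≥ μ_a(S₂, t₂); in particular, the union of a maximizer at t₁ with any maximizer at t₂ is again a maximizer at t₂. -/
open scoped Classical

/-- A set function with increasing marginals satisfies the lattice form of supermodularity. -/
theorem add_le_union_add_inter_of_increasing_marginals {α : Type*} [DecidableEq α]
    {f : Finset α → ℝ}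
    (hf : ∀ (S T : Finset α) (i : α), S ⊆ T → i ∉ T →
      f (insert i S) - f S ≤ f (insert i T) - f T)
    (A B : Finset α) : f A + f B ≤ f (A ∪ B) + f (A ∩ B) := by
  have key : ∀ (S T D : Finset α), S ⊆ T → Disjoint D T →
      f (D ∪ S) - f S ≤ f (D ∪ T) - f T := by
    intro S T D hST
    induction D using Finset.induction_on with
    | empty => simp
    | insert i D hi ih =>
      intro hD
      rw [Finset.disjoint_insert_left] at hD
      have hstep := hf (D ∪ S) (D ∪ T) i (Finset.union_subset_union_right hST)
        (by simp [hi, hD.1])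
      rw [Finset.insert_union, Finset.insert_union]
      linarith [ih hD.2]
  have h := key (A ∩ B) B (A \ B) Finset.inter_subset_right Finset.sdiff_disjoint
  rw [Finset.sdiff_union_inter, Finset.sdiff_union_self_eq_union] at h
  linarith

/-- Single-agent setting with supermodular, monotone `f`.
If `0 ≤ t₁ ≤ t₂` and `S₁` maximizes the agent's utility `μ_a(·,t₁)`, then for every
`S₂ ⊆ [n]` we have `μ_a(S₁ ∪ S₂, t₂) ≥ μ_a(S₂, t₂)`; in particular the union of a
maximizer at `t₁` with any maximizer at `t₂` is again a maximizer at `t₂`. -/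
theorem stmt_1 (n : ℕ) (f : Finset (Fin n) → ℝ) (c : Fin n → ℝ)
    (hmono : ∀ S T : Finset (Fin n), S ⊆ T → f S ≤ f T)
    (hsuper : ∀ (S T : Finset (Fin n)) (i : Fin n), S ⊆ T → i ∉ T →
      f (insert i S) - f S ≤ f (insert i T) - f T)
    (hf0 : f ∅ = 0) (hf1 : ∀ S : Finset (Fin n), f S ≤ 1)
    (hc : ∀ i : Fin n, 0 < c i)
    (t₁ t₂ : ℝ) (ht₁ : 0 ≤ t₁) (ht₁₂ : t₁ ≤ t₂)
    (S₁ : Finset (Fin n))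
    (hS₁ : ∀ T : Finset (Fin n),
      t₁ * f T - ∑ i ∈ T, c i ≤ t₁ * f S₁ - ∑ i ∈ S₁, c i) :
    (∀ S₂ : Finset (Fin n),
      t₂ * f S₂ - ∑ i ∈ S₂, c i ≤ t₂ * f (S₁ ∪ S₂) - ∑ i ∈ S₁ ∪ S₂, c i) ∧
    (∀ S₂ : Finset (Fin n),
      (∀ T : Finset (Fin n), t₂ * f T - ∑ i ∈ T, c i ≤ t₂ * f S₂ - ∑ i ∈ S₂, c i) →
      ∀ T : Finset (Fin n),
        t₂ * f T - ∑ i ∈ T, c i ≤ t₂ * f (S₁ ∪ S₂) - ∑ i ∈ S₁ ∪ S₂, c i) := by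
  have hunion : ∀ S₂ : Finset (Fin n),
      t₂ * f S₂ - ∑ i ∈ S₂, c i ≤ t₂ * f (S₁ ∪ S₂) - ∑ i ∈ S₁ ∪ S₂, c i := by
    intro S₂
    have hlattice := add_le_union_add_inter_of_increasing_marginals hsuper S₁ S₂
    have hcost := Finset.sum_union_inter (s₁ := S₁) (s₂ := S₂) (f := c)
    have hopt := hS₁ (S₁ ∩ S₂)
    have hincr := hmono S₂ (S₁ ∪ S₂) Finset.subset_union_right
    have hmarg : t₁ * (f S₁ - f (S₁ ∩ S₂)) ≤ t₁ * (f (S₁ ∪ S₂) - f S₂) :=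
      mul_le_mul_of_nonneg_left (by linarith) ht₁
    have hcontract : t₁ * (f (S₁ ∪ S₂) - f S₂) ≤ t₂ * (f (S₁ ∪ S₂) - f S₂) :=
      mul_le_mul_of_nonneg_right ht₁₂ (by linarith)
    linarith
  exact ⟨hunion, fun S₂ hS₂ T => (hS₂ T).trans (hunion S₂)⟩
end

section
/- Suppose f is supermodular and monotone. For each t ≥ 0 let Φ(t) denote the union of all maximizers of μ_a(·, t). Then: (i) Φ(t) is itself a maximizer at t; (ii) Φ is monotone in t, i.e., 0 ≤ t₁ ≤ t₂ implies Φ(t₁) ⊆ Φ(t₂); and consequently (iii) the map t ↦ Φ(t) takes at most n + 1 distinct values as t ranges over [0, 1] (there are at most n + 1 sets in demand). -/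
open scoped Classical

/-- Increasing marginals of single elements extend to marginals of sets. -/
lemma marginal_le_marginal_of_subset {α : Type*} [DecidableEq α] {f : Finset α → ℝ}
    (hsuper : ∀ (S T : Finset α) (i : α), S ⊆ T → i ∉ T →
      f (insert i S) - f S ≤ f (insert i T) - f T)
    {A B : Finset α} (hAB : A ⊆ B) (U : Finset α) (hU : Disjoint U B) :
    f (U ∪ A) - f A ≤ f (U ∪ B) - f B := by
  induction U using Finset.induction_on with
  | empty => simp
  | insert i U hi ih =>
    rw [Finset.disjoint_insert_left] at hU
    have hstep := hsuper (U ∪ A) (U ∪ B) i (Finset.union_subset_union_right hAB)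
      (by simp [hi, hU.1])
    rw [Finset.insert_union, Finset.insert_union]
    linarith [ih hU.2]

/-- Lattice form of supermodularity. -/
lemma add_le_union_add_inter_of_supermodular {α : Type*} [DecidableEq α] {f : Finset α → ℝ}
    (hsuper : ∀ (S T : Finset α) (i : α), S ⊆ T → i ∉ T →
      f (insert i S) - f S ≤ f (insert i T) - f T) (S T : Finset α) :
    f S + f T ≤ f (S ∪ T) + f (S ∩ T) := by
  have h := marginal_le_marginal_of_subset hsuper (Finset.inter_subset_right (s₁ := S) (s₂ := T))
    (S \ T) Finset.sdiff_disjoint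
  rw [Finset.sdiff_union_inter, Finset.sdiff_union_self_eq_union] at h
  linarith

/-- The union of a maximizer at `t₁` and a maximizer at `t₂ ≥ t₁` is a maximizer at `t₂`. -/
lemma union_maximizer {α : Type*} [DecidableEq α] {f : Finset α → ℝ} {c : α → ℝ}
    (hmono : ∀ S T : Finset α, S ⊆ T → f S ≤ f T)
    (hsuper : ∀ (S T : Finset α) (i : α), S ⊆ T → i ∉ T →
      f (insert i S) - f S ≤ f (insert i T) - f T)
    {t₁ t₂ : ℝ} (ht₁ : 0 ≤ t₁) (ht : t₁ ≤ t₂) {S T : Finset α}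
    (hS : ∀ R : Finset α, t₁ * f R - ∑ i ∈ R, c i ≤ t₁ * f S - ∑ i ∈ S, c i)
    (hT : ∀ R : Finset α, t₂ * f R - ∑ i ∈ R, c i ≤ t₂ * f T - ∑ i ∈ T, c i)
    (R : Finset α) :
    t₂ * f R - ∑ i ∈ R, c i ≤ t₂ * f (S ∪ T) - ∑ i ∈ S ∪ T, c i := by
  have hcost : ∑ i ∈ S ∪ T, c i + ∑ i ∈ S ∩ T, c i = ∑ i ∈ S, c i + ∑ i ∈ T, c i :=
    Finset.sum_union_inter
  have hlattice := add_le_union_add_inter_of_supermodular hsuper S T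
  have hinter := hmono (S ∩ T) S Finset.inter_subset_left
  have hmarginal : t₁ * (f S - f (S ∩ T)) ≤ t₂ * (f (S ∪ T) - f T) :=
    mul_le_mul ht (by linarith) (by linarith) (ht₁.trans ht)
  linarith [hS (S ∩ T), hT R]

/-- Single-agent setting with supermodular, monotone `f`. For each `t`
let `Φ t` be the union of all maximizers of `μ_a(·,t)`. Then (i) `Φ t` is itself a
maximizer at every `t ≥ 0`; (ii) `Φ` is monotone: `0 ≤ t₁ ≤ t₂` implies `Φ t₁ ⊆ Φ t₂`;
(iii) `Φ` takes at most `n + 1` distinct values on `[0,1]`. -/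
theorem stmt_2 (n : ℕ) (f : Finset (Fin n) → ℝ) (c : Fin n → ℝ)
    (hmono : ∀ S T : Finset (Fin n), S ⊆ T → f S ≤ f T)
    (hsuper : ∀ (S T : Finset (Fin n)) (i : Fin n), S ⊆ T → i ∉ T →
      f (insert i S) - f S ≤ f (insert i T) - f T)
    (hf0 : f ∅ = 0) (hf1 : ∀ S : Finset (Fin n), f S ≤ 1)
    (hc : ∀ i : Fin n, 0 < c i) :
    ∀ Φ : ℝ → Finset (Fin n),
      (Φ = fun t => (Finset.univ.filter
          (fun S : Finset (Fin n) =>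
            ∀ T : Finset (Fin n),
              t * f T - ∑ i ∈ T, c i ≤ t * f S - ∑ i ∈ S, c i)).sup id) →
      (∀ t : ℝ, 0 ≤ t →
        ∀ T : Finset (Fin n),
          t * f T - ∑ i ∈ T, c i ≤ t * f (Φ t) - ∑ i ∈ Φ t, c i) ∧
      (∀ t₁ t₂ : ℝ, 0 ≤ t₁ → t₁ ≤ t₂ → Φ t₁ ⊆ Φ t₂) ∧
      (Φ '' Set.Icc (0:ℝ) 1).ncard ≤ n + 1 := by
  intro Φ hΦ
  have hmax : ∀ t : ℝ, 0 ≤ t → ∀ T : Finset (Fin n),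
      t * f T - ∑ i ∈ T, c i ≤ t * f (Φ t) - ∑ i ∈ Φ t, c i := by
    intro t ht
    obtain ⟨M, hM⟩ := Finite.exists_max fun S : Finset (Fin n) => t * f S - ∑ i ∈ S, c i
    have hne : (Finset.univ.filter (fun S : Finset (Fin n) => ∀ T : Finset (Fin n),
        t * f T - ∑ i ∈ T, c i ≤ t * f S - ∑ i ∈ S, c i)).Nonempty :=
      ⟨M, by simpa using hM⟩
    simp only [hΦ]
    rw [← Finset.sup'_eq_sup hne]
    refine Finset.sup'_induction (p := fun S => ∀ T : Finset (Fin n),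
      t * f T - ∑ i ∈ T, c i ≤ t * f S - ∑ i ∈ S, c i) hne id ?_ ?_
    · intro S hS T hT
      exact union_maximizer hmono hsuper ht le_rfl hS hT
    · intro S hS
      exact (Finset.mem_filter.mp hS).2
  have hsub : ∀ t₁ t₂ : ℝ, 0 ≤ t₁ → t₁ ≤ t₂ → Φ t₁ ⊆ Φ t₂ := by
    intro t₁ t₂ h₁ h₂
    have hunion := union_maximizer hmono hsuper h₁ h₂ (hmax t₁ h₁) (hmax t₂ (h₁.trans h₂))
    have hle : Φ t₁ ∪ Φ t₂ ⊆ Φ t₂ := by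
      conv_rhs => rw [hΦ]
      exact Finset.le_sup (f := id) (Finset.mem_filter.mpr ⟨Finset.mem_univ _, hunion⟩)
    exact Finset.subset_union_left.trans hle
  refine ⟨hmax, hsub, ?_⟩
  have hinj : Set.InjOn Finset.card (Φ '' Set.Icc (0:ℝ) 1) := by
    rintro _ ⟨s, hs, rfl⟩ _ ⟨t, ht, rfl⟩ hcard
    rcases le_total s t with hst | hts
    · exact Finset.eq_of_subset_of_card_le (hsub s t hs.1 hst) hcard.ge
    · exact (Finset.eq_of_subset_of_card_le (hsub t s ht.1 hts) hcard.le).symm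
  rw [← hinj.ncard_image]
  have hrange : Finset.card '' (Φ '' Set.Icc (0:ℝ) 1) ⊆ (Finset.range (n + 1) : Set ℕ) := by
    rintro _ ⟨S, -, rfl⟩
    simpa [Nat.lt_succ_iff] using Finset.card_le_univ S
  simpa using Set.ncard_le_ncard hrange (Finset.finite_toSet _)
end

section
/- Let L and R be two sets in demand with f(L) < f(R). Then the break point of R equals the intersection contract of L and R, i.e., κ_R = IC(L,R), if and only if L and R are adjacent. -/
open scoped Classical

/-- total cost of a set of actions -/
noncomputable def cost {n : ℕ} (c : Fin n → ℝ) (S : Finset (Fin n)) : ℝ := ∑ i ∈ S, c i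

/-- the agent's expected utility `μ_a(S,t) = t·f(S) − c(S)` -/
noncomputable def mua {n : ℕ} (f : Finset (Fin n) → ℝ) (c : Fin n → ℝ)
    (S : Finset (Fin n)) (t : ℝ) : ℝ := t * f S - cost c S

/-- `S` is a maximizer of `μ_a(·,t)` -/
def IsMaximizer {n : ℕ} (f : Finset (Fin n) → ℝ) (c : Fin n → ℝ)
    (S : Finset (Fin n)) (t : ℝ) : Prop :=
  ∀ T : Finset (Fin n), mua f c T t ≤ mua f c S t

/-- `S` is in demand at `t`: it is a maximizer, and among maximizers it has the highest
reward (ties broken in favor of the principal). -/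
def InDemandAt {n : ℕ} (f : Finset (Fin n) → ℝ) (c : Fin n → ℝ)
    (S : Finset (Fin n)) (t : ℝ) : Prop :=
  IsMaximizer f c S t ∧ ∀ T : Finset (Fin n), IsMaximizer f c T t → f T ≤ f S

/-- `S` is in demand (at some contract `t ∈ [0,1]`). -/
def InDemand {n : ℕ} (f : Finset (Fin n) → ℝ) (c : Fin n → ℝ)
    (S : Finset (Fin n)) : Prop :=
  ∃ t ∈ Set.Icc (0:ℝ) 1, InDemandAt f c S t

/-- the break point `κ_R = inf {t ∈ [0,1] : R is in demand at t}` -/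
noncomputable def breakPoint {n : ℕ} (f : Finset (Fin n) → ℝ) (c : Fin n → ℝ)
    (R : Finset (Fin n)) : ℝ :=
  sInf {t ∈ Set.Icc (0:ℝ) 1 | InDemandAt f c R t}

/-- the intersection contract `IC(L,R) = (c(L) − c(R))/(f(L) − f(R))` -/
noncomputable def interContract {n : ℕ} (f : Finset (Fin n) → ℝ) (c : Fin n → ℝ)
    (L R : Finset (Fin n)) : ℝ :=
  (cost c L - cost c R) / (f L - f R)

/-- demanded sets `L, R` with `f(L) < f(R)` are adjacent when no demanded set lies
strictly between them in reward. -/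
def Adjacent {n : ℕ} (f : Finset (Fin n) → ℝ) (c : Fin n → ℝ)
    (L R : Finset (Fin n)) : Prop :=
  ¬ ∃ S : Finset (Fin n), InDemand f c S ∧ f L < f S ∧ f S < f R

section

variable {n : ℕ} {f : Finset (Fin n) → ℝ} {c : Fin n → ℝ} {L R S T : Finset (Fin n)} {s t : ℝ}

/-- Some set is in demand at every contract. -/
theorem exists_inDemandAt (f : Finset (Fin n) → ℝ) (c : Fin n → ℝ) (t : ℝ) :
    ∃ S, InDemandAt f c S t := by
  obtain ⟨M, hM⟩ := Finite.exists_max fun S => mua f c S t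
  obtain ⟨S, hS, hmax⟩ := (Set.toFinite {S | IsMaximizer f c S t}).exists_maximalFor f _ ⟨M, hM⟩
  refine ⟨S, hS, fun T hT => ?_⟩
  by_contra! h
  exact (hmax hT h.le).not_gt h

theorem IsMaximizer.cost_le (hS : IsMaximizer f c S t) (h : f S = f T) :
    cost c S ≤ cost c T := by
  have := hS T
  simp only [mua, h] at this
  linarith

theorem InDemandAt.of_cost_le (hS : InDemandAt f c S t) (h : f S = f T)
    (hcost : cost c T ≤ cost c S) : InDemandAt f c T t := by
  refine ⟨fun U => (hS.1 U).trans ?_, fun U hU => h ▸ hS.2 U hU⟩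
  simp only [mua, h]
  linarith

theorem lt_interContract_iff (h : f L < f R) :
    t < interContract f c L R ↔ mua f c R t < mua f c L t := by
  rw [interContract, ← neg_div_neg_eq, lt_div_iff₀ (by linarith), mua, mua]
  constructor <;> intro _ <;> linarith

theorem InDemandAt.lt_interContract (hL : InDemandAt f c L t) (h : f L < f R) :
    t < interContract f c L R := by
  rw [lt_interContract_iff h]
  by_contra! hle
  exact h.not_ge (hL.2 R fun T => (hL.1 T).trans hle)

theorem InDemandAt.interContract_le (hR : InDemandAt f c R t) (h : f L < f R) :
    interContract f c L R ≤ t := by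
  rw [← not_lt, lt_interContract_iff h, not_lt]
  exact hR.1 L

/-- The reward of the demanded set is monotone in the contract. -/
theorem InDemandAt.reward_le (hS : InDemandAt f c S s) (hT : InDemandAt f c T t) (h : s ≤ t) :
    f S ≤ f T := by
  by_contra! hlt
  exact ((hT.lt_interContract hlt).trans_le (hS.interContract_le hlt)).not_ge h

theorem interContract_le_breakPoint (hR : InDemand f c R) (h : f L < f R) :
    interContract f c L R ≤ breakPoint f c R :=
  le_csInf hR fun _ ht => ht.2.interContract_le h

theorem breakPoint_le (ht : t ∈ Set.Icc (0 : ℝ) 1) (hR : InDemandAt f c R t) :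
    breakPoint f c R ≤ t :=
  csInf_le ⟨0, fun _ h => h.1.1⟩ ⟨ht, hR⟩

/-- If the intersection contracts of consecutive sets increase, the outer intersection contract
lies below the larger one. -/
theorem interContract_lt_of_lt (hLS : f L < f S) (hSR : f S < f R)
    (h : interContract f c L S < interContract f c S R) :
    interContract f c L R < interContract f c S R := by
  have hLS' : interContract f c L S * (f L - f S) = cost c L - cost c S :=
    div_mul_cancel₀ _ (sub_ne_zero.2 hLS.ne)
  have hSR' : interContract f c S R * (f S - f R) = cost c S - cost c R :=
    div_mul_cancel₀ _ (sub_ne_zero.2 hSR.ne)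
  have hLR' : interContract f c L R = (cost c L - cost c R) / (f L - f R) := rfl
  rw [hLR', ← neg_div_neg_eq, div_lt_iff₀ (by linarith)]
  nlinarith [mul_lt_mul_of_pos_right h (sub_pos.2 hLS)]

end

/-- For sets `L, R` in demand with `f(L) < f(R)`, the break point of `R`
equals the intersection contract of `L` and `R` if and only if `L` and `R` are adjacent. -/
theorem stmt_3 (n : ℕ) (f : Finset (Fin n) → ℝ) (c : Fin n → ℝ)
    (hmono : ∀ S T : Finset (Fin n), S ⊆ T → f S ≤ f T)
    (hf0 : f ∅ = 0) (hf1 : ∀ S : Finset (Fin n), f S ≤ 1)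
    (hc : ∀ i : Fin n, 0 < c i)
    (L R : Finset (Fin n)) (hL : InDemand f c L) (hR : InDemand f c R)
    (hLR : f L < f R) :
    breakPoint f c R = interContract f c L R ↔ Adjacent f c L R := by
  obtain ⟨s, hs, hLs⟩ := hL
  have hle := interContract_le_breakPoint hR hLR
  constructor
  · rintro heq ⟨S, ⟨u, -, hSu⟩, hLS, hSR⟩
    have hlt := interContract_lt_of_lt hLS hSR
      ((hSu.interContract_le hLS).trans_lt (hSu.lt_interContract hSR))
    exact (hlt.trans_le (interContract_le_breakPoint hR hSR)).ne' heq
  · intro hadj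
    by_contra hne
    obtain ⟨t, hLt, htR⟩ := exists_between (lt_of_le_of_ne hle (Ne.symm hne))
    obtain ⟨r, hr, hRr⟩ := hR
    have hst : s < t := (hLs.lt_interContract hLR).trans hLt
    have htr : t < r := htR.trans_le (breakPoint_le hr hRr)
    have ht : t ∈ Set.Icc (0 : ℝ) 1 := ⟨hs.1.trans hst.le, htr.le.trans hr.2⟩
    obtain ⟨S, hS⟩ := exists_inDemandAt f c t
    refine hadj ⟨S, ⟨t, ht, hS⟩, (hLs.reward_le hS hst.le).lt_of_ne fun h => ?_,
      (hS.reward_le hRr htr.le).lt_of_ne fun h => ?_⟩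
    · exact hLt.not_gt
        ((hS.of_cost_le h.symm (hLs.1.cost_le h)).lt_interContract hLR)
    · exact htR.not_ge (breakPoint_le ht (hS.of_cost_le h (hRr.1.cost_le h.symm)))
end

section
/- Let L and R be two non-adjacent sets in demand with f(L) < f(R). Then any set S that is in demand at the contract t = IC(L,R) satisfies f(L) < f(S) < f(R). -/
open scoped Classical

/-- A set in demand is strictly preferred to every set of higher reward. -/
theorem InDemandAt.mua_lt {n : ℕ} {f : Finset (Fin n) → ℝ} {c : Fin n → ℝ}
    {L M : Finset (Fin n)} {t : ℝ} (h : InDemandAt f c L t) (hLM : f L < f M) :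
    mua f c M t < mua f c L t := by
  by_contra! hle
  exact (h.2 M fun T => (h.1 T).trans hle).not_gt hLM

/-- The intersection contract equalizes the utilities of the two sets. -/
theorem mua_interContract {n : ℕ} {f : Finset (Fin n) → ℝ} {c : Fin n → ℝ}
    {L R : Finset (Fin n)} (h : f L ≠ f R) :
    mua f c L (interContract f c L R) = mua f c R (interContract f c L R) := by
  have key : interContract f c L R * (f L - f R) = cost c L - cost c R :=
    div_mul_cancel₀ _ (sub_ne_zero.mpr h)
  unfold mua
  linarith

/-- Strict single crossing: if `A` is weakly preferred to `B` at `s` and `B` is strictly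
preferred to `A` at `t`, then the reward of `B` exceeds that of `A` in the direction of `t - s`. -/
theorem mul_sub_pos_of_mua {n : ℕ} {f : Finset (Fin n) → ℝ} {c : Fin n → ℝ}
    {A B : Finset (Fin n)} {s t : ℝ} (hs : mua f c B s ≤ mua f c A s)
    (ht : mua f c A t < mua f c B t) : 0 < (t - s) * (f B - f A) := by
  unfold mua at hs ht
  linarith

/-- Let `L` and `R` be two non-adjacent sets in demand with
`f(L) < f(R)`. Then any set `S` in demand at the contract `t = IC(L,R)` satisfies
`f(L) < f(S) < f(R)`. -/
theorem stmt_4 (n : ℕ) (f : Finset (Fin n) → ℝ) (c : Fin n → ℝ)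
    (hmono : ∀ S T : Finset (Fin n), S ⊆ T → f S ≤ f T)
    (hf0 : f ∅ = 0) (hf1 : ∀ S : Finset (Fin n), f S ≤ 1)
    (hc : ∀ i : Fin n, 0 < c i)
    (L R : Finset (Fin n)) (hL : InDemand f c L) (hR : InDemand f c R)
    (hLR : f L < f R) (hadj : ¬ Adjacent f c L R)
    (S : Finset (Fin n)) (hS : InDemandAt f c S (interContract f c L R)) :
    f L < f S ∧ f S < f R := by
  obtain ⟨l, -, hl⟩ := hL
  obtain ⟨r, -, hr⟩ := hR
  unfold Adjacent at hadj
  obtain ⟨M, ⟨m, -, hm⟩, hLM, hMR⟩ := not_not.mp hadj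
  have heq := mua_interContract (c := c) hLR.ne
  generalize interContract f c L R = t at hS heq
  have hML : mua f c L t < mua f c M t := by
    by_contra! hle
    have h₁ := mul_sub_pos_of_mua (heq ▸ hle) (hm.mua_lt hMR)
    have h₂ := hm.1 L
    have hmt : m < t := by nlinarith
    unfold mua at hle h₂
    nlinarith
  have hlt : l < t := by
    have := mul_sub_pos_of_mua (hl.1 M) hML
    nlinarith
  have htr : t < r := by
    have := mul_sub_pos_of_mua (s := r) (t := t) (hr.1 M) (heq ▸ hML)
    nlinarith
  have hSL : mua f c L t < mua f c S t := hML.trans_le (hS.1 M)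
  have hLS := mul_sub_pos_of_mua (hl.1 S) hSL
  have hSR := mul_sub_pos_of_mua (hr.1 S) (heq ▸ hSL)
  constructor <;> nlinarith
end

section
/- Let k ≥ 2 and let G be a simple graph on n ≥ 2 vertices containing no clique of size k (K_k-free). With uniform reparameterized cost c = (k−2)/(k−1), for every S ⊆ V such that deg_S(v) ≥ 1 for all v ∈ S, the principal's utility satisfies μ_p(S) ≤ 0. -/
open scoped Classical
open Finset

/-- `degIn G S v` is the degree of `v` into `S`: the number of neighbors of `v`
lying inside `S`. -/
noncomputable def degIn {V : Type*} (G : SimpleGraph V) (S : Finset V) (v : V) : ℕ :=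
  (S.filter fun u => G.Adj v u).card

/-- `edgesIn G S` is `|E(S)|`: the number of edges of `G` with both endpoints in `S`. -/
noncomputable def edgesIn {V : Type*} [Fintype V] (G : SimpleGraph V) (S : Finset V) : ℕ :=
  (G.edgeFinset.filter fun e => ∀ v ∈ e, v ∈ S).card

/-- `E_max = n(n−1)/2`, the maximum possible number of edges on `n` vertices. -/
noncomputable def Emax (n : ℕ) : ℝ := (n : ℝ) * ((n : ℝ) - 1) / 2

/-- the left term `L(S) = 1 − ∑_{v∈S} c / deg_S(v)` of the principal's objective -/
noncomputable def Lobj {V : Type*} (G : SimpleGraph V) (c : ℝ) (S : Finset V) : ℝ :=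
  1 - ∑ v ∈ S, c / (degIn G S v : ℝ)

/-- the relaxed left term `𝓛(S) = 1 − ∑_{v∈S} c / (deg_S(v) + 1)` -/
noncomputable def Lrel {V : Type*} (G : SimpleGraph V) (c : ℝ) (S : Finset V) : ℝ :=
  1 - ∑ v ∈ S, c / ((degIn G S v : ℝ) + 1)

/-- the right term `R(S) = |E(S)| / E_max` of the principal's objective -/
noncomputable def Robj {V : Type*} [Fintype V] (G : SimpleGraph V) (S : Finset V) : ℝ :=
  (edgesIn G S : ℝ) / Emax (Fintype.card V)

/-- the principal's utility `μ_p(S) = L(S)·R(S)` in the uniform-cost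
graph-supermodular contract problem -/
noncomputable def muP {V : Type*} [Fintype V] (G : SimpleGraph V) (c : ℝ) (S : Finset V) : ℝ :=
  Lobj G c S * Robj G S

/-- The loose form of **Turán's theorem**: a `K_{r+1}`-free graph on `n` vertices has at most
`(1 - 1/r) n²/2` edges. -/
theorem SimpleGraph.CliqueFree.two_mul_mul_card_edgeFinset_le {V : Type*} [Fintype V]
    {G : SimpleGraph V} {r : ℕ} (hG : G.CliqueFree (r + 1)) :
    2 * r * #G.edgeFinset ≤ (r - 1) * Fintype.card V ^ 2 := by
  have h := hG.card_edgeFinset_le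
  simp only [← SimpleGraph.card_edgeFinset_turanGraph] at h
  exact (Nat.mul_le_mul_left _ h).trans SimpleGraph.mul_card_edgeFinset_turanGraph_le

theorem degree_induce_eq_degIn {V : Type*} (G : SimpleGraph V) (S : Finset V) (v : S) :
    (G.induce (S : Set V)).degree v = degIn G S v := by
  rw [← SimpleGraph.card_neighborFinset_eq_degree, degIn]
  refine Finset.card_bij (fun u _ => (u : V)) ?_ ?_ ?_
  · intro u hu
    simpa using hu
  · intro u _ w _ h
    exact Subtype.ext h
  · intro u hu
    rw [Finset.mem_filter] at hu
    exact ⟨⟨u, hu.1⟩, by simpa using hu.2, rfl⟩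

/-- Turán's bound for the sum of the degrees inside a vertex subset of a clique-free graph. -/
theorem mul_sum_degIn_le {V : Type*} {G : SimpleGraph V} {r : ℕ}
    (hG : G.CliqueFree (r + 1)) (S : Finset V) :
    r * ∑ v ∈ S, degIn G S v ≤ (r - 1) * #S ^ 2 := by
  have hfree : (G.induce (S : Set V)).CliqueFree (r + 1) :=
    hG.comap ⟨(SimpleGraph.Embedding.induce (S : Set V)).toCopy⟩
  have hsum : ∑ v ∈ S, degIn G S v = 2 * #(G.induce (S : Set V)).edgeFinset := by
    rw [← SimpleGraph.sum_degrees_eq_twice_card_edges, ← Finset.sum_coe_sort S]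
    exact Finset.sum_congr rfl fun v _ => (degree_induce_eq_degIn G S v).symm
  have h := hfree.two_mul_mul_card_edgeFinset_le
  have hcard : Fintype.card (S : Set V) = #S := by simp
  rw [hcard] at h
  rw [hsum]
  convert h using 1
  rw [← mul_assoc, mul_comm r 2]
  congr!

theorem Lobj_nonpos_of_cliqueFree {V : Type*} {G : SimpleGraph V} {k : ℕ} (hk : 2 ≤ k)
    (hG : G.CliqueFree k) {S : Finset V} (hS : S.Nonempty) (hdeg : ∀ v ∈ S, 1 ≤ degIn G S v) :
    Lobj G (((k : ℝ) - 2) / ((k : ℝ) - 1)) S ≤ 0 := by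
  obtain ⟨r, rfl⟩ := Nat.exists_eq_add_of_le' hk
  have hturan : ((r : ℝ) + 1) * ∑ v ∈ S, (degIn G S v : ℝ) ≤ r * (#S : ℝ) ^ 2 := by
    exact_mod_cast mul_sum_degIn_le hG S
  have hpos : ∀ v ∈ S, (0 : ℝ) < degIn G S v := fun v hv => by exact_mod_cast hdeg v hv
  have hsum : 0 < ∑ v ∈ S, (degIn G S v : ℝ) := Finset.sum_pos hpos hS
  have hcs := Finset.sq_sum_div_le_sum_sq_div S (fun _ => (1 : ℝ)) hpos
  simp only [Finset.sum_const, nsmul_eq_mul, mul_one, one_pow] at hcs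
  have hc : (((r + 2 : ℕ) : ℝ) - 2) / (((r + 2 : ℕ) : ℝ) - 1) = r / (r + 1) := by
    push_cast
    ring
  rw [Lobj, hc, sub_nonpos]
  calc (1 : ℝ) ≤ r / (r + 1) * ((#S : ℝ) ^ 2 / ∑ v ∈ S, (degIn G S v : ℝ)) := by
        rw [div_mul_div_comm, one_le_div (by positivity)]
        exact hturan
    _ ≤ r / (r + 1) * ∑ v ∈ S, 1 / (degIn G S v : ℝ) := by gcongr
    _ = ∑ v ∈ S, (r / (r + 1) : ℝ) / (degIn G S v : ℝ) := by
        simp only [Finset.mul_sum, mul_one_div]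

theorem Robj_nonneg {V : Type*} [Fintype V] (G : SimpleGraph V) (S : Finset V)
    (hV : 1 ≤ Fintype.card V) : 0 ≤ Robj G S := by
  have h : (0 : ℝ) ≤ (Fintype.card V : ℝ) - 1 := sub_nonneg.mpr (by exact_mod_cast hV)
  unfold Robj Emax
  positivity

theorem Robj_empty {V : Type*} [Fintype V] (G : SimpleGraph V) : Robj G ∅ = 0 := by
  have h : edgesIn G ∅ = 0 := by
    rw [edgesIn, Finset.card_eq_zero, Finset.filter_eq_empty_iff]
    intro e _ he
    induction e with
    | h a b => exact Finset.notMem_empty a (he a (Sym2.mem_mk_left a b))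
  simp [Robj, h]

/-- Let `k ≥ 2` and let `G` be a `K_k`-free simple graph on `n ≥ 2`
vertices. With uniform reparameterized cost `c = (k−2)/(k−1)`, every `S ⊆ V` with
`deg_S(v) ≥ 1` for all `v ∈ S` yields nonpositive principal utility: `μ_p(S) ≤ 0`. -/
theorem stmt_7 {V : Type*} [Fintype V] (G : SimpleGraph V) (k : ℕ) (hk : 2 ≤ k)
    (hn : 2 ≤ Fintype.card V) (hfree : G.CliqueFree k)
    (S : Finset V) (hdeg : ∀ v ∈ S, 1 ≤ degIn G S v) :
    muP G (((k : ℝ) - 2) / ((k : ℝ) - 1)) S ≤ 0 := by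
  rcases S.eq_empty_or_nonempty with rfl | hS
  · simp [muP, Robj_empty]
  · exact mul_nonpos_of_nonpos_of_nonneg (Lobj_nonpos_of_cliqueFree hk hfree hS hdeg)
      (Robj_nonneg G S (by lia))
end

section
/- Let c ≥ 0, let G be a simple graph, let S ⊆ V be nonempty, and let v ∈ S be a vertex of minimum degree in S, i.e., deg_S(v) ≤ deg_S(u) for all u ∈ S. Then the relaxed objective does not decrease upon removing v: 𝓛(S \ {v}) ≥ 𝓛(S). -/
open scoped Classical
open Finset

/-- Removing a vertex `v ∈ S` lowers the degree into `S` of exactly the neighbors of `v`,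
by one. -/
lemma degIn_erase_add {V : Type*} (G : SimpleGraph V) {S : Finset V} {v : V} (hv : v ∈ S)
    (u : V) : degIn G (S.erase v) u + (if G.Adj v u then 1 else 0) = degIn G S u := by
  unfold degIn
  rw [Finset.filter_erase]
  split_ifs with h
  · exact Finset.card_erase_add_one (Finset.mem_filter.2 ⟨hv, h.symm⟩)
  · rw [Finset.erase_eq_of_notMem, add_zero]
    exact fun hm => h (Finset.mem_filter.1 hm).2.symm

/-- The cost share of a vertex `u` of degree at least `deg_S(v)` grows by at most
`c / (deg_S(v) (deg_S(v) + 1))` when `v` is removed, and only if `u` is a neighbor of `v`. -/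
lemma div_degIn_erase_le {V : Type*} (G : SimpleGraph V) {c : ℝ} (hc : 0 ≤ c)
    {S : Finset V} {u v : V} (hv : v ∈ S) (hu : u ∈ S) (huv : degIn G S v ≤ degIn G S u) :
    c / ((degIn G (S.erase v) u : ℝ) + 1) ≤ c / ((degIn G S u : ℝ) + 1) +
      if G.Adj v u then c / ((degIn G S v : ℝ) * ((degIn G S v : ℝ) + 1)) else 0 := by
  have h := degIn_erase_add G hv u
  split_ifs at h ⊢ with hadj
  · have hpos : 0 < degIn G S v :=
      Finset.card_pos.2 ⟨u, Finset.mem_filter.2 ⟨hu, hadj⟩⟩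
    have hd : (0 : ℝ) < degIn G S v := by exact_mod_cast hpos
    have hle : (degIn G S v : ℝ) ≤ degIn G S u := by exact_mod_cast huv
    have he : (degIn G (S.erase v) u : ℝ) + 1 = degIn G S u := by exact_mod_cast h
    rw [he]
    have hx : (0 : ℝ) < degIn G S u := hd.trans_le hle
    have hsplit : c / (degIn G S u : ℝ) = c / ((degIn G S u : ℝ) + 1) +
        c / ((degIn G S u : ℝ) * ((degIn G S u : ℝ) + 1)) := by
      field_simp
    rw [hsplit]
    gcongr
  · rw [← h, add_zero, add_zero]

/-- Let `c ≥ 0`, `S ⊆ V` nonempty, and let `v ∈ S` have minimum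
degree in `S`. Then the relaxed objective does not decrease upon removing `v`:
`𝓛(S \ {v}) ≥ 𝓛(S)`. -/
theorem stmt_11 {V : Type*} (G : SimpleGraph V) (c : ℝ) (hc : 0 ≤ c)
    (S : Finset V) (hS : S.Nonempty) (v : V) (hv : v ∈ S)
    (hmin : ∀ u ∈ S, degIn G S v ≤ degIn G S u) :
    Lrel G c S ≤ Lrel G c (S.erase v) := by
  have hsum : ∑ u ∈ S.erase v, c / ((degIn G (S.erase v) u : ℝ) + 1) ≤
      ∑ u ∈ S.erase v, c / ((degIn G S u : ℝ) + 1) + ∑ u ∈ S.erase v,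
        if G.Adj v u then c / ((degIn G S v : ℝ) * ((degIn G S v : ℝ) + 1)) else 0 := by
    rw [← Finset.sum_add_distrib]
    exact Finset.sum_le_sum fun u hu =>
      have huS := Finset.mem_of_mem_erase hu
      div_degIn_erase_le G hc hv huS (hmin u huS)
  have hdeg : degIn G (S.erase v) v = degIn G S v := by
    simpa using degIn_erase_add G hv v
  have hnbr : (∑ u ∈ S.erase v,
      if G.Adj v u then c / ((degIn G S v : ℝ) * ((degIn G S v : ℝ) + 1)) else 0) ≤
        c / ((degIn G S v : ℝ) + 1) := by
    rw [← Finset.sum_filter, Finset.sum_const, nsmul_eq_mul]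
    change (degIn G (S.erase v) v : ℝ) * _ ≤ _
    rw [hdeg]
    rcases (Nat.cast_nonneg (α := ℝ) (degIn G S v)).eq_or_lt with h0 | hpos
    · rw [← h0, zero_mul]
      positivity
    · apply le_of_eq
      field_simp
  have hS' := Finset.add_sum_erase S (fun u => c / ((degIn G S u : ℝ) + 1)) hv
  unfold Lrel
  linarith
end

section
/- Let ε ∈ (0, 1/7], set β = (1−ε)ε/3, let G be a simple graph on n ≥ 2 vertices, let K ⊆ V, and let v ∈ V be a vertex with deg_K(v) ≥ ε·β·n/9. Let m ≥ (3⁶/ε⁴)·ln n and let Y₁,…,Y_m be i.i.d. uniform random samples from K; let X = |{j : Y_j is adjacent to v}|. Then Pr[ |(|K|/m)·X − deg_K(v)| > ε·deg_K(v) ] ≤ 1/(2n³). -/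
open scoped Classical
open Finset

/-- The exponential moment of the number of samples satisfying `P`, summed over all sample
sequences, factors over the coordinates. -/
lemma sum_exp_mul_card_filter {α : Type*} [Fintype α] (P : α → Prop) (m : ℕ) (t : ℝ) :
    ∑ ω : Fin m → α, Real.exp (t * ((univ.filter fun j => P (ω j)).card : ℝ))
      = (∑ x, Real.exp (t * if P x then 1 else 0)) ^ m := by
  rw [Fintype.sum_pow]
  refine Finset.sum_congr rfl fun ω _ => ?_
  rw [← Real.exp_sum, ← Finset.mul_sum, Finset.sum_boole]

lemma sum_exp_mul_indicator_le {α : Type*} [Fintype α] [Nonempty α] (P : α → Prop) {t : ℝ}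
    (ht : |t| ≤ 1) :
    ∑ x, Real.exp (t * if P x then 1 else 0)
      ≤ Fintype.card α *
        Real.exp (((univ.filter P).card : ℝ) / Fintype.card α * (t + t ^ 2)) := by
  have hk : (0 : ℝ) < Fintype.card α := by exact_mod_cast Fintype.card_pos
  have hexp : Real.exp t - 1 ≤ t + t ^ 2 := by
    have := (abs_le.mp (Real.abs_exp_sub_one_sub_id_le ht)).2
    linarith
  have hsum : ∑ x, Real.exp (t * if P x then 1 else 0)
      = Fintype.card α + ((univ.filter P).card : ℝ) * (Real.exp t - 1) := by
    have hterm : ∀ x, Real.exp (t * if P x then 1 else 0)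
        = 1 + (if P x then 1 else 0) * (Real.exp t - 1) := by
      intro x
      split_ifs <;> simp
    simp only [hterm, Finset.sum_add_distrib, ← Finset.sum_mul, Finset.sum_boole]
    simp
  calc ∑ x, Real.exp (t * if P x then 1 else 0)
      ≤ Fintype.card α + ((univ.filter P).card : ℝ) * (t + t ^ 2) := by
        rw [hsum]
        gcongr
    _ = Fintype.card α *
        (((univ.filter P).card : ℝ) / Fintype.card α * (t + t ^ 2) + 1) := by
        field_simp
        ring
    _ ≤ _ := by
        gcongr
        exact Real.add_one_le_exp _

/-- Exponential Markov bound for the number of uniform samples satisfying `P`. -/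
lemma card_filter_le_mul_card_le {α : Type*} [Fintype α] [Nonempty α] (P : α → Prop) (m : ℕ)
    {t : ℝ} (ht : |t| ≤ 1) (a : ℝ) :
    ((univ.filter fun ω : Fin m → α =>
        a ≤ t * ((univ.filter fun j => P (ω j)).card : ℝ)).card : ℝ)
      ≤ (Fintype.card α : ℝ) ^ m *
        Real.exp (m * (((univ.filter P).card : ℝ) / Fintype.card α * (t + t ^ 2)) - a) := by
  set B := univ.filter fun ω : Fin m → α =>
        a ≤ t * ((univ.filter fun j => P (ω j)).card : ℝ)
  have hmarkov : (B.card : ℝ) * Real.exp a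
      ≤ ∑ ω : Fin m → α, Real.exp (t * ((univ.filter fun j => P (ω j)).card : ℝ)) := by
    rw [← nsmul_eq_mul]
    refine (Finset.card_nsmul_le_sum B _ _ fun ω hω => ?_).trans
      (Finset.sum_le_sum_of_subset_of_nonneg (Finset.subset_univ B)
        fun _ _ _ => (Real.exp_pos _).le)
    exact Real.exp_le_exp.mpr (Finset.mem_filter.mp hω).2
  rw [sum_exp_mul_card_filter] at hmarkov
  rw [Real.exp_sub, ← mul_div_assoc, le_div_iff₀ (Real.exp_pos a), Real.exp_nat_mul, ← mul_pow]
  exact hmarkov.trans (pow_le_pow_left₀ (Finset.sum_nonneg fun _ _ => (Real.exp_pos _).le)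
    (sum_exp_mul_indicator_le P ht) m)

/-- Two-sided multiplicative Chernoff bound for uniform sampling with replacement. -/
lemma card_filter_abs_sub_gt_le {α : Type*} [Fintype α] [Nonempty α] (P : α → Prop) {m : ℕ}
    (hm : 0 < m) {ε : ℝ} (hε : 0 ≤ ε) (hε' : ε ≤ 1) :
    ((univ.filter fun ω : Fin m → α =>
        ε * ((univ.filter P).card : ℝ) <
          |(Fintype.card α : ℝ) / m * ((univ.filter fun j => P (ω j)).card : ℝ)
            - ((univ.filter P).card : ℝ)|).card : ℝ)
      ≤ (Fintype.card α : ℝ) ^ m *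
        (2 * Real.exp (-(m * (((univ.filter P).card : ℝ) / Fintype.card α) * ε ^ 2 / 4))) := by
  have hk : (0 : ℝ) < Fintype.card α := by exact_mod_cast Fintype.card_pos
  have hm' : (0 : ℝ) < m := by exact_mod_cast hm
  set d : ℝ := ((univ.filter P).card : ℝ)
  set k : ℝ := (Fintype.card α : ℝ)
  set μ : ℝ := m * (d / k) with hμ
  have hd : d = k / m * μ := by
    rw [hμ]
    field_simp
  have hupper := card_filter_le_mul_card_le P m (t := ε / 2)
    (by rw [abs_le]; constructor <;> linarith) (ε / 2 * ((1 + ε) * μ))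
  have hlower := card_filter_le_mul_card_le P m (t := -(ε / 2))
    (by rw [abs_le]; constructor <;> linarith) (-(ε / 2) * ((1 - ε) * μ))
  rw [show (m : ℝ) * (d / k * (ε / 2 + (ε / 2) ^ 2)) - ε / 2 * ((1 + ε) * μ)
    = -(μ * ε ^ 2 / 4) by rw [hμ]; ring] at hupper
  rw [show (m : ℝ) * (d / k * (-(ε / 2) + (-(ε / 2)) ^ 2)) - -(ε / 2) * ((1 - ε) * μ)
    = -(μ * ε ^ 2 / 4) by rw [hμ]; ring] at hlower
  have hcover : (univ.filter fun ω : Fin m → α =>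
        ε * d < |k / m * ((univ.filter fun j => P (ω j)).card : ℝ) - d|) ⊆
      (univ.filter fun ω : Fin m → α =>
        ε / 2 * ((1 + ε) * μ) ≤ ε / 2 * ((univ.filter fun j => P (ω j)).card : ℝ)) ∪
      (univ.filter fun ω : Fin m → α =>
        -(ε / 2) * ((1 - ε) * μ) ≤ -(ε / 2) * ((univ.filter fun j => P (ω j)).card : ℝ)) := by
    intro ω hω
    simp only [Finset.mem_union, Finset.mem_filter, Finset.mem_univ, true_and] at hω ⊢
    set X : ℝ := ((univ.filter fun j => P (ω j)).card : ℝ)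
    have hkm : 0 < k / m := div_pos hk hm'
    rcases lt_abs.mp hω with h | h
    · left
      have : k / m * ((1 + ε) * μ) < k / m * X := by linear_combination h - (1 + ε) * hd
      exact mul_le_mul_of_nonneg_left (lt_of_mul_lt_mul_left this hkm.le).le (by linarith)
    · right
      have : k / m * X < k / m * ((1 - ε) * μ) := by linear_combination h + (1 - ε) * hd
      exact mul_le_mul_of_nonpos_left (lt_of_mul_lt_mul_left this hkm.le).le (by linarith)
  have hcard := (Finset.card_le_card hcover).trans (Finset.card_union_le _ _)
  have hcard' : ((univ.filter fun ω : Fin m → α =>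
        ε * d < |k / m * ((univ.filter fun j => P (ω j)).card : ℝ) - d|).card : ℝ) ≤ _ :=
    Nat.cast_le.mpr hcard
  rw [Nat.cast_add] at hcard'
  linarith

/-- Chernoff estimate for high-degree vertices. Let `ε ∈ (0,1/7]`,
`β = (1−ε)ε/3`, `G` a simple graph on `n ≥ 2` vertices, `K ⊆ V`, and `v` a vertex with
`deg_K(v) ≥ ε·β·n/9`. For `m ≥ (3⁶/ε⁴)·ln n` i.i.d. uniform samples `Y₁,…,Y_m` from `K`
(the joint outcome being uniform over `K^m`), letting `X` be the number of samples
adjacent to `v`, the estimator `(|K|/m)·X` is within `ε·deg_K(v)` of `deg_K(v)` except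
with probability at most `1/(2n³)`. -/
theorem stmt_16 {V : Type*} [Fintype V] (G : SimpleGraph V) (ε : ℝ)
    (hε : ε ∈ Set.Ioc (0:ℝ) (1/7)) (hn : 2 ≤ Fintype.card V)
    (K : Finset V) (v : V)
    (hdeg : ε * ((1 - ε) * ε / 3) * (Fintype.card V : ℝ) / 9 ≤ (degIn G K v : ℝ))
    (m : ℕ) (hm : (3 ^ 6 / ε ^ 4) * Real.log (Fintype.card V) ≤ (m : ℝ)) :
    ((Finset.univ.filter (fun ω : Fin m → {x // x ∈ K} =>
        ε * (degIn G K v : ℝ) <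
          |((K.card : ℝ) / (m : ℝ))
              * ((Finset.univ.filter (fun j : Fin m => G.Adj v (ω j).1)).card : ℝ)
            - (degIn G K v : ℝ)|)).card : ℝ)
      / (Fintype.card (Fin m → {x // x ∈ K}) : ℝ)
      ≤ 1 / (2 * (Fintype.card V : ℝ) ^ 3) := by
  obtain ⟨hε0, hε7⟩ := hε
  have hn2 : (2 : ℝ) ≤ Fintype.card V := by exact_mod_cast hn
  set n : ℝ := (Fintype.card V : ℝ)
  have hn0 : 0 < n := by linarith
  have hlog : 0 < Real.log n := Real.log_pos (by linarith)
  have hm0 : (0 : ℝ) < m := lt_of_lt_of_le (by positivity) hm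
  have hd0 : (0 : ℝ) < degIn G K v := by
    refine lt_of_lt_of_le ?_ hdeg
    have : 0 < 1 - ε := by linarith
    positivity
  have hdK : degIn G K v ≤ K.card := Finset.card_filter_le _ _
  have hK : 0 < K.card := lt_of_lt_of_le (by exact_mod_cast hd0) hdK
  have hK0 : (0 : ℝ) < K.card := by exact_mod_cast hK
  have hKn : (K.card : ℝ) ≤ n := Nat.cast_le.mpr (Finset.card_le_univ K)
  have : Nonempty {x // x ∈ K} := (Finset.card_pos.mp hK).to_subtype
  have hdeg_eq :
      (univ.filter fun x : {x // x ∈ K} => G.Adj v x.1).card = degIn G K v := by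
    rw [degIn, ← Fintype.card_subtype, ← Fintype.card_coe]
    refine Fintype.card_congr ((Equiv.subtypeSubtypeEquivSubtypeInter _ _).trans
      (Equiv.subtypeEquivRight fun x => ?_))
    simp
  have hchernoff := card_filter_abs_sub_gt_le (fun x : {x // x ∈ K} => G.Adj v x.1)
    (m := m) (by exact_mod_cast hm0) hε0.le (by linarith)
  rw [hdeg_eq, Fintype.card_coe] at hchernoff
  have hp : ε ^ 2 * (2 / 63) ≤ (degIn G K v : ℝ) / K.card := by
    rw [le_div_iff₀ hK0]
    calc ε ^ 2 * (2 / 63) * K.card ≤ ε ^ 2 * ((1 - ε) / 27) * n := by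
          have : 2 / 63 ≤ (1 - ε) / 27 := by linarith
          have : 0 ≤ (1 - ε) / 27 := by linarith
          gcongr
      _ ≤ (degIn G K v : ℝ) := by linarith
  have hexponent : 5 * Real.log n ≤ m * ((degIn G K v : ℝ) / K.card) * ε ^ 2 / 4 := by
    calc 5 * Real.log n
        ≤ (3 ^ 6 / ε ^ 4 * Real.log n) * (ε ^ 2 * (2 / 63)) * ε ^ 2 / 4 := by
          rw [show (3 ^ 6 / ε ^ 4 * Real.log n) * (ε ^ 2 * (2 / 63)) * ε ^ 2 / 4
            = 81 / 14 * Real.log n by field_simp; norm_num]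
          linarith
      _ ≤ _ := by gcongr
  have htail : 2 * Real.exp (-(m * ((degIn G K v : ℝ) / K.card) * ε ^ 2 / 4))
      ≤ 1 / (2 * n ^ 3) := by
    calc 2 * Real.exp (-(m * ((degIn G K v : ℝ) / K.card) * ε ^ 2 / 4))
        ≤ 2 * Real.exp (-(5 * Real.log n)) := by gcongr
      _ = 2 / n ^ 5 := by
          rw [Real.exp_neg, mul_comm (5 : ℝ), Real.exp_mul, Real.exp_log hn0]
          norm_cast
      _ ≤ 1 / (2 * n ^ 3) := by
          rw [div_le_div_iff₀ (by positivity) (by positivity)]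
          have : 4 ≤ n ^ 2 := by nlinarith
          nlinarith [pow_pos hn0 3]
  rw [div_le_iff₀ (by exact_mod_cast Fintype.card_pos), Fintype.card_fun, Fintype.card_fin,
    Fintype.card_coe, Nat.cast_pow,
    mul_comm (1 / (2 * n ^ 3))]
  exact hchernoff.trans (by gcongr)
end

section
/- Let ε ∈ (0, 1/7], set β = (1−ε)ε/3, let G be a simple graph on n ≥ 324/ε⁸ vertices, let K ⊆ V with |K| ≥ ε·n/3, and let v ∈ V be a vertex with deg_K(v) < ε·β·n/9. Let m ≥ (3⁶/ε⁴)·ln n and let Y₁,…,Y_m be i.i.d. uniform random samples from K; let X = |{j : Y_j is adjacent to v}|. Then Pr[ (|K|/m)·X ≥ β·n ] ≤ 1/(2n³). -/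
open scoped Classical
open Finset

/-- Exponential Markov bound, in counting form, for the number of `m` independent uniform samples
that satisfy `P`. -/
theorem card_le_card_filter_div_card_le_exp {α : Type*} [Fintype α] [Nonempty α] (P : α → Prop)
    (m : ℕ) (t : ℝ) :
    ((univ.filter fun ω : Fin m → α =>
        t ≤ ((univ.filter fun j => P (ω j)).card : ℝ)).card : ℝ)
      / (Fintype.card (Fin m → α) : ℝ)
      ≤ Real.exp (2 * m * ((univ.filter P).card / Fintype.card α) - t) := by
  have hk : (0 : ℝ) < Fintype.card α := by exact_mod_cast Fintype.card_pos
  set k : ℝ := (Fintype.card α : ℝ) with hkdef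
  set c : ℝ := ((univ.filter P).card : ℝ)
  have hmgf : ∑ ω : Fin m → α, Real.exp ((univ.filter fun j => P (ω j)).card : ℝ)
      = (∑ a, if P a then Real.exp 1 else 1) ^ m := by
    rw [Fintype.sum_pow]
    refine Finset.sum_congr rfl fun ω _ => ?_
    rw [Finset.prod_ite, Finset.prod_const, Finset.prod_const_one, mul_one, ← Real.exp_nat_mul,
      mul_one]
  have hsum : (∑ a, if P a then Real.exp 1 else 1) ≤ k * Real.exp (2 * (c / k)) := by
    calc (∑ a, if P a then Real.exp 1 else 1)
        ≤ ∑ a, (1 + 2 * if P a then (1 : ℝ) else 0) := by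
          refine Finset.sum_le_sum fun a _ => ?_
          split_ifs
          · linarith [Real.exp_one_lt_d9]
          · simp
      _ = k * (2 * (c / k) + 1) := by
          rw [Finset.sum_add_distrib, ← Finset.mul_sum, Finset.sum_boole]
          simp only [sum_const, card_univ, nsmul_eq_mul, mul_one]
          field_simp
          ring
      _ ≤ k * Real.exp (2 * (c / k)) := by
          gcongr
          exact Real.add_one_le_exp _
  have hmarkov : ((univ.filter fun ω : Fin m → α =>
        t ≤ ((univ.filter fun j => P (ω j)).card : ℝ)).card : ℝ) * Real.exp t
      ≤ ∑ ω : Fin m → α, Real.exp ((univ.filter fun j => P (ω j)).card : ℝ) := by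
    rw [← nsmul_eq_mul]
    refine (Finset.card_nsmul_le_sum _ _ _ fun ω hω => ?_).trans
      (Finset.sum_le_sum_of_subset_of_nonneg (Finset.filter_subset _ _)
        fun _ _ _ => (Real.exp_pos _).le)
    exact Real.exp_le_exp.2 (Finset.mem_filter.1 hω).2
  have hpow : (∑ a, if P a then Real.exp 1 else 1) ^ m
      ≤ k ^ m * Real.exp (2 * m * (c / k)) := by
    calc (∑ a, if P a then Real.exp 1 else 1) ^ m ≤ (k * Real.exp (2 * (c / k))) ^ m :=
          pow_le_pow_left₀ (Finset.sum_nonneg fun a _ => by split_ifs <;> positivity) hsum m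
      _ = k ^ m * Real.exp (2 * m * (c / k)) := by
          rw [mul_pow, ← Real.exp_nat_mul]
          ring_nf
  have hcard : (Fintype.card (Fin m → α) : ℝ) = k ^ m := by simp [hkdef]
  rw [hcard, div_le_iff₀ (by positivity), Real.exp_sub, div_mul_eq_mul_div,
    le_div_iff₀ (Real.exp_pos t)]
  linarith

/-- Chernoff estimate for low-degree vertices. Let `ε ∈ (0,1/7]`,
`β = (1−ε)ε/3`, `G` a simple graph on `n ≥ 324/ε⁸` vertices, `K ⊆ V` with
`|K| ≥ ε·n/3`, and `v` a vertex with `deg_K(v) < ε·β·n/9`. For `m ≥ (3⁶/ε⁴)·ln n`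
i.i.d. uniform samples `Y₁,…,Y_m` from `K` (the joint outcome being uniform over
`K^m`), letting `X` be the number of samples adjacent to `v`, the estimator
`(|K|/m)·X` exceeds `β·n` with probability at most `1/(2n³)`. -/
theorem stmt_17 {V : Type*} [Fintype V] (G : SimpleGraph V) (ε : ℝ)
    (hε : ε ∈ Set.Ioc (0:ℝ) (1/7))
    (hn : 324 / ε ^ 8 ≤ (Fintype.card V : ℝ))
    (K : Finset V) (hK : ε * (Fintype.card V : ℝ) / 3 ≤ (K.card : ℝ))
    (v : V)
    (hdeg : (degIn G K v : ℝ) < ε * ((1 - ε) * ε / 3) * (Fintype.card V : ℝ) / 9)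
    (m : ℕ) (hm : (3 ^ 6 / ε ^ 4) * Real.log (Fintype.card V) ≤ (m : ℝ)) :
    ((Finset.univ.filter (fun ω : Fin m → {x // x ∈ K} =>
        ((1 - ε) * ε / 3) * (Fintype.card V : ℝ) ≤
          ((K.card : ℝ) / (m : ℝ))
            * ((Finset.univ.filter (fun j : Fin m => G.Adj v (ω j).1)).card : ℝ))).card : ℝ)
      / (Fintype.card (Fin m → {x // x ∈ K}) : ℝ)
      ≤ 1 / (2 * (Fintype.card V : ℝ) ^ 3) := by
  obtain ⟨hε0, hε1⟩ := hε
  set n : ℝ := (Fintype.card V : ℝ)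
  have hn2 : 2 ≤ n := by
    refine le_trans ?_ hn
    rw [le_div_iff₀ (by positivity)]
    have : ε ^ 8 ≤ 1 := pow_le_one₀ hε0.le (by linarith)
    linarith
  have hn0 : 0 < n := by linarith
  have hk : (0 : ℝ) < K.card := lt_of_lt_of_le (by positivity) hK
  have hkn : (K.card : ℝ) ≤ n := Nat.cast_le.2 (Finset.card_le_univ K)
  have hlog : 0 < Real.log n := Real.log_pos (by linarith)
  have hm0 : (0 : ℝ) < m := lt_of_lt_of_le (by positivity) hm
  have hne : Nonempty {x // x ∈ K} :=
    (Finset.card_pos.1 (by exact_mod_cast hk)).to_subtype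
  set β : ℝ := (1 - ε) * ε / 3 with hβ
  have hβ0 : 0 < β := by
    have : 0 < 1 - ε := by linarith
    positivity
  have hiff : ∀ x : ℝ, β * n ≤ K.card / m * x ↔ m * (β * n / K.card) ≤ x := fun x => by
    rw [div_mul_eq_mul_div (K.card : ℝ), le_div_iff₀ hm0, ← mul_div_assoc, div_le_iff₀ hk, mul_comm (m : ℝ),
      mul_comm x]
  have hdegcard : (univ.filter fun x : {x // x ∈ K} => G.Adj v x.1).card = degIn G K v := by
    rw [degIn, ← Finset.card_map (Function.Embedding.subtype _)]
    congr 1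
    ext x
    simp [and_comm]
  have key := card_le_card_filter_div_card_le_exp (fun x : {x // x ∈ K} => G.Adj v x.1) m
    (m * (β * n / K.card))
  rw [hdegcard, Fintype.card_coe] at key
  simp only [hiff]
  refine key.trans ?_
  have hq : β ≤ β * n / K.card := by
    rw [le_div_iff₀ hk]
    gcongr
  have hp : (degIn G K v : ℝ) / K.card ≤ β * n / K.card / 4 := by
    rw [div_right_comm]
    gcongr
    have : ε * (β * n) ≤ 1 * (β * n) := by
      gcongr
      linarith
    nlinarith [mul_pos hβ0 hn0]
  have hmβ : 8 * Real.log n ≤ m * β := by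
    have hcoef : 8 ≤ 3 ^ 6 / ε ^ 4 * β := by
      rw [div_mul_eq_mul_div, le_div_iff₀ (by positivity), hβ]
      have h3 : ε ^ 3 ≤ 1 := pow_le_one₀ hε0.le (by linarith)
      nlinarith [mul_le_mul_of_nonneg_left h3 hε0.le]
    calc 8 * Real.log n ≤ 3 ^ 6 / ε ^ 4 * β * Real.log n := by gcongr
      _ = 3 ^ 6 / ε ^ 4 * Real.log n * β := by ring
      _ ≤ m * β := by gcongr
  have hexp : 2 * m * ((degIn G K v : ℝ) / K.card) - m * (β * n / K.card) ≤ -(4 * Real.log n) := by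
    nlinarith [mul_le_mul_of_nonneg_left hp hm0.le, mul_le_mul_of_nonneg_left hq hm0.le]
  calc Real.exp (2 * m * ((degIn G K v : ℝ) / K.card) - m * (β * n / K.card))
      ≤ Real.exp (-(4 * Real.log n)) := Real.exp_le_exp.2 hexp
    _ = 1 / (n * n ^ 3) := by
        rw [Real.exp_neg, mul_comm, Real.exp_mul, Real.exp_log hn0, one_div]
        norm_cast
        rw [pow_succ']
    _ ≤ 1 / (2 * n ^ 3) := by gcongr
end
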